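/- arXiv:2403.04339 — 2 statements merged into one kernel-verified Lean document; each statement's English description precedes it below -/
import Mathlib

section
/- Fix integers m ≥ n ≥ 1, let R = ℂ[x_{ij}], t : R^n → R^m the generic matrix map, tᵗ its transpose, coKer := coker t, K := coker tᵗ, and set c := m − n + 1. Then for every 0 ≤ j ≤ c, the annihilator in R of the R-module Sym^{c−j}_R K ⊗_R ⋀^j_R coKer is equal to the ideal I_n(T) ⊆ R generated by the n×n (maximal) minors of the generic matrix T = (x_{ij}). -/
open scoped TensorProduct

noncomputable section

/-- The polynomial ring `R = ℂ[x_{ij} : 1 ≤ i ≤ m, 1 ≤ j ≤ n]` in `mn` variables. -/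
abbrev GenRing (m n : ℕ) : Type :=
  MvPolynomial (Fin m × Fin n) ℂ

/-- The generic `m × n` matrix `T = (x_{ij})`, regarded as an `R`-linear map `t : Rⁿ → Rᵐ`. -/
def genMap (m n : ℕ) : (Fin n → GenRing m n) →ₗ[GenRing m n] (Fin m → GenRing m n) :=
  Matrix.mulVecLin (Matrix.of fun i j => MvPolynomial.X (i, j))

/-- `coKer := coker t`, the cokernel of the generic matrix map. -/
abbrev genCoker (m n : ℕ) : Type :=
  (Fin m → GenRing m n) ⧸ LinearMap.range (genMap m n)

/-- `K := coker tᵗ`, the cokernel of the transpose `tᵗ : (Rᵐ)^∨ → (Rⁿ)^∨` of the generic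
matrix map. -/
abbrev genK (m n : ℕ) : Type :=
  Module.Dual (GenRing m n) (Fin n → GenRing m n) ⧸ LinearMap.range (genMap m n).dualMap

/-- The relations submodule defining the `k`-th symmetric power. -/
def SymPow.rel (R : Type*) [CommRing R] (N : Type*) [AddCommGroup N] [Module R N]
    (k : ℕ) : Submodule R (⨂[R]^k N) :=
  Submodule.span R {x | ∃ (v : Fin k → N) (e : Equiv.Perm (Fin k)),
    x = PiTensorProduct.tprod R v - PiTensorProduct.tprod R (v ∘ e)}

/-- The `k`-th symmetric power `Sym^k N` of an `R`-module `N`. -/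
abbrev SymPow (R : Type*) [CommRing R] (N : Type*) [AddCommGroup N] [Module R N]
    (k : ℕ) : Type _ :=
  (⨂[R]^k N) ⧸ SymPow.rel R N k

/-- The ideal `I_n(T)` of `R` generated by the `n × n` (maximal) minors of the generic
`m × n` matrix `T = (x_{ij})`. -/
def maximalMinorsIdeal (m n : ℕ) : Ideal (GenRing m n) :=
  Ideal.span {p | ∃ rows : Fin n → Fin m, Function.Injective rows ∧
    p = Matrix.det (Matrix.of fun a b : Fin n => MvPolynomial.X (rows a, b))}

section FischerPairing

variable {σ : Type*} [Fintype σ]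

/-- The bilinear pairing on polynomials for which monomials are orthogonal and `x ^ α` pairs with
itself to `α!`. -/
def fischer (σ : Type*) [Fintype σ] :
    MvPolynomial σ ℂ →ₗ[ℂ] MvPolynomial σ ℂ →ₗ[ℂ] ℂ :=
  (MvPolynomial.basisMonomials σ ℂ).constr ℂ
    fun α => ((∏ i, (α i).factorial : ℕ) : ℂ) • MvPolynomial.lcoeff ℂ α

theorem fischer_monomial (α : σ →₀ ℕ) (a : ℂ) (g : MvPolynomial σ ℂ) :
    fischer σ (MvPolynomial.monomial α a) g =
      a * ((∏ i, (α i).factorial : ℕ) : ℂ) * g.coeff α := by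
  have h : MvPolynomial.monomial α a = a • MvPolynomial.basisMonomials σ ℂ α := by
    simp [MvPolynomial.smul_monomial]
  rw [h, map_smul, fischer, Module.Basis.constr_basis]
  simp [mul_assoc]

theorem fischer_comm (f g : MvPolynomial σ ℂ) : fischer σ f g = fischer σ g f := by
  classical
  induction f using MvPolynomial.induction_on' with
  | add p q hp hq => simp [hp, hq]
  | monomial α a =>
    induction g using MvPolynomial.induction_on' with
    | add p q hp hq => simp [hp, hq]
    | monomial β b =>
      rw [fischer_monomial, fischer_monomial, MvPolynomial.coeff_monomial,
        MvPolynomial.coeff_monomial]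
      by_cases h : α = β
      · subst h; simp; ring
      · simp [h, Ne.symm h]

theorem fischer_X_mul (u : σ) (f g : MvPolynomial σ ℂ) :
    fischer σ (MvPolynomial.X u * f) g = fischer σ f (MvPolynomial.pderiv u g) := by
  classical
  induction f using MvPolynomial.induction_on' with
  | add p q hp hq => simp [mul_add, hp, hq]
  | monomial α a =>
    have h : MvPolynomial.X u * MvPolynomial.monomial α a =
        MvPolynomial.monomial (α + Finsupp.single u 1) a := by
      rw [MvPolynomial.X, MvPolynomial.monomial_mul, one_mul, add_comm]
    have h2 : ∏ i, ((α + Finsupp.single u 1 : σ →₀ ℕ) i).factorial =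
        (α u + 1) * ∏ i, (α i).factorial := by
      rw [← Finset.mul_prod_erase _ _ (Finset.mem_univ u),
        ← Finset.mul_prod_erase _ (fun i => (α i).factorial) (Finset.mem_univ u), ← mul_assoc]
      congr 1
      · simp [Nat.factorial_succ]
      · refine Finset.prod_congr rfl fun i hi => ?_
        simp [Finset.ne_of_mem_erase hi]
    rw [h, fischer_monomial, fischer_monomial, MvPolynomial.coeff_pderiv, h2]
    push_cast
    ring

theorem fischer_pderiv (u : σ) (f g : MvPolynomial σ ℂ) :
    fischer σ (MvPolynomial.pderiv u f) g = fischer σ f (MvPolynomial.X u * g) := by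
  rw [fischer_comm, ← fischer_X_mul, fischer_comm]

theorem eq_zero_of_fischer_conj_self (f : MvPolynomial σ ℂ)
    (h : fischer σ (MvPolynomial.map (starRingEnd ℂ) f) f = 0) : f = 0 := by
  classical
  have key : fischer σ (MvPolynomial.map (starRingEnd ℂ) f) f =
      ((∑ α ∈ f.support, ‖f.coeff α‖ ^ 2 * ((∏ i, (α i).factorial : ℕ) : ℝ) : ℝ) : ℂ) := by
    conv_lhs => enter [1]; rw [f.as_sum]
    rw [map_sum, map_sum, LinearMap.sum_apply, Complex.ofReal_sum]
    refine Finset.sum_congr rfl fun α _ => ?_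
    rw [MvPolynomial.map_monomial, fischer_monomial, mul_right_comm, Complex.conj_mul']
    push_cast
    ring
  rw [key, Complex.ofReal_eq_zero, Finset.sum_eq_zero_iff_of_nonneg (fun _ _ => by positivity)] at h
  ext α
  by_contra hα
  have h1 := h α (MvPolynomial.mem_support_iff.mpr hα)
  have h2 : (0 : ℝ) < ((∏ i, (α i).factorial : ℕ) : ℝ) := by
    exact_mod_cast Finset.prod_pos fun i _ => Nat.factorial_pos _
  have h3 : 0 < ‖f.coeff α‖ := norm_pos_iff.mpr hα
  exact absurd h1 (by positivity)

/-- A conjugation-stable finite-dimensional subspace of polynomials is complemented by its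
orthogonal with respect to the Fischer pairing. -/
theorem exists_mem_fischer_sub_eq_zero (N : Submodule ℂ (MvPolynomial σ ℂ))
    [FiniteDimensional ℂ N]
    (hN : ∀ f ∈ N, MvPolynomial.map (starRingEnd ℂ) f ∈ N) (f : MvPolynomial σ ℂ) :
    ∃ g ∈ N, ∀ h ∈ N, fischer σ h (f - g) = 0 := by
  let B : N →ₗ[ℂ] Module.Dual ℂ N :=
    { toFun := fun g => ((fischer σ).flip g.1).comp N.subtype
      map_add' := fun a b => by ext; simp
      map_smul' := fun a b => by ext; simp }
  have hB : Function.Injective B := by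
    rw [← LinearMap.ker_eq_bot, LinearMap.ker_eq_bot']
    intro g hg
    have := LinearMap.congr_fun hg ⟨_, hN g.1 g.2⟩
    exact Subtype.ext (eq_zero_of_fischer_conj_self g.1 (by simpa [B] using this))
  have hs : Function.Surjective B :=
    (LinearMap.injective_iff_surjective_of_finrank_eq_finrank
      (Subspace.dual_finrank_eq (K := ℂ) (V := N)).symm).mp hB
  obtain ⟨g, hg⟩ := hs (((fischer σ).flip f).comp N.subtype)
  refine ⟨g.1, g.2, fun h hh => ?_⟩
  have := LinearMap.congr_fun hg ⟨h, hh⟩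
  simp only [B, LinearMap.coe_mk, AddHom.coe_mk, LinearMap.comp_apply, Submodule.subtype_apply,
    LinearMap.flip_apply] at this
  rw [map_sub, this, sub_self]

end FischerPairing

section GenericDeterminant

variable {ι : Type*} [Fintype ι] [DecidableEq ι]

theorem degreeOf_det_mvPolynomialX_le (p : ι × ι) :
    (Matrix.mvPolynomialX ι ι ℂ).det.degreeOf p ≤ 1 := by
  rw [Matrix.det_apply]
  refine (MvPolynomial.degreeOf_sum_le _ _ _).trans (Finset.sup_le fun s _ => ?_)
  have h : (Equiv.Perm.sign s • ∏ i, Matrix.mvPolynomialX ι ι ℂ (s i) i).degreeOf p ≤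
      (∏ i, Matrix.mvPolynomialX ι ι ℂ (s i) i).degreeOf p := by
    rcases Int.units_eq_one_or (Equiv.Perm.sign s) with h | h
    · rw [h, one_smul]
    · rw [h, Units.neg_smul, one_smul, MvPolynomial.degreeOf_neg]
  refine h.trans ((MvPolynomial.degreeOf_prod_le _ _ _).trans ?_)
  calc ∑ i, (Matrix.mvPolynomialX ι ι ℂ (s i) i).degreeOf p
      ≤ ∑ i, if i = p.2 then 1 else 0 := by
        refine Finset.sum_le_sum fun i _ => ?_
        rw [Matrix.mvPolynomialX_apply, MvPolynomial.degreeOf_X]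
        by_cases h1 : p = (s i, i)
        · rw [if_pos h1, if_pos (by rw [h1])]
        · rw [if_neg h1]
          exact Nat.zero_le _
    _ = 1 := by simp

theorem squarefree_det_mvPolynomialX : Squarefree (Matrix.mvPolynomialX ι ι ℂ).det := by
  rintro a ⟨b, hab⟩
  have h0 := Matrix.det_mvPolynomialX_ne_zero ι ℂ
  rw [hab] at h0
  have ha : a ≠ 0 := fun h => h0 (by simp [h])
  have hb : b ≠ 0 := fun h => h0 (by simp [h])
  have hdeg : ∀ p, a.degreeOf p = 0 := fun p => by
    have := degreeOf_det_mvPolynomialX_le p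
    rw [hab, MvPolynomial.degreeOf_mul_eq (mul_ne_zero ha ha) hb,
      MvPolynomial.degreeOf_mul_eq ha ha] at this
    omega
  have hvars : a.vars = ∅ := by
    ext p
    simp [MvPolynomial.mem_vars_iff_degreeOf_ne_zero, hdeg p]
  rw [MvPolynomial.vars_eq_empty_iff_eq_C] at hvars
  rw [hvars]
  refine (isUnit_iff_ne_zero.mpr fun h => ha ?_).map MvPolynomial.C
  rw [hvars, h, map_zero]

/-- A polynomial vanishing on all singular matrices is divisible by the generic determinant. -/
theorem det_mvPolynomialX_dvd_of_eval_eq_zero (f : MvPolynomial (ι × ι) ℂ)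
    (hf : ∀ A : Matrix ι ι ℂ, A.det = 0 → MvPolynomial.eval (fun p => A p.1 p.2) f = 0) :
    (Matrix.mvPolynomialX ι ι ℂ).det ∣ f := by
  have h : f ∈ (Ideal.span {(Matrix.mvPolynomialX ι ι ℂ).det}).radical := by
    rw [← MvPolynomial.vanishingIdeal_zeroLocus_eq_radical (K := ℂ), MvPolynomial.mem_vanishingIdeal_iff]
    intro x hx
    rw [MvPolynomial.mem_zeroLocus_iff] at hx
    have := hx _ (Ideal.mem_span_singleton_self _)
    rw [MvPolynomial.aeval_eq_eval, Matrix.eval_det_mvPolynomialX] at this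
    have h := hf (Matrix.of fun i j => x (i, j)) this
    simp only [Matrix.of_apply, Prod.mk.eta] at h
    rwa [MvPolynomial.aeval_eq_eval]
  obtain ⟨k, hk⟩ := h
  rw [Ideal.mem_span_singleton] at hk
  exact squarefree_det_mvPolynomialX.isRadical k f hk

end GenericDeterminant

section Polarization

variable {ι κ : Type*} [Fintype κ]

/-- The polarization operator `∑ b, x_{ib} ∂/∂x_{jb}`. -/
def polarization (κ : Type*) [Fintype κ] (i j : ι) :
    Derivation ℂ (MvPolynomial (ι × κ) ℂ) (MvPolynomial (ι × κ) ℂ) :=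
  ∑ b : κ, (MvPolynomial.X (i, b) : MvPolynomial (ι × κ) ℂ) • MvPolynomial.pderiv (j, b)

theorem polarization_apply (i j : ι) (f : MvPolynomial (ι × κ) ℂ) :
    polarization κ i j f = ∑ b : κ, MvPolynomial.X (i, b) * MvPolynomial.pderiv (j, b) f := by
  rw [polarization, ← Derivation.coeFnAddMonoidHom_apply, map_sum, Finset.sum_apply]
  rfl

theorem polarization_X (i j : ι) [DecidableEq ι] (k : ι) (b : κ) :
    polarization κ i j (MvPolynomial.X (k, b)) = if k = j then MvPolynomial.X (i, b) else 0 := by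
  classical
  rw [polarization_apply]
  simp only [MvPolynomial.pderiv_X, Pi.single_apply, Prod.mk.injEq]
  by_cases h : k = j <;> simp [h]

theorem fischer_polarization [Fintype ι] (i j : ι) (f g : MvPolynomial (ι × κ) ℂ) :
    fischer (ι × κ) (polarization κ i j f) g = fischer (ι × κ) f (polarization κ j i g) := by
  simp only [polarization_apply, map_sum, LinearMap.sum_apply]
  refine Finset.sum_congr rfl fun b _ => ?_
  rw [fischer_X_mul, fischer_pderiv]

/-- Weighting the variables of row `a` by `w a`, the polarization operator shifts the weight of
each monomial by `w i - w j`. -/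
theorem exists_coeff_ne_zero_of_coeff_polarization_ne_zero [Fintype ι] (w : ι → ℕ)
    {i j : ι} {f : MvPolynomial (ι × κ) ℂ}
    {α : ι × κ →₀ ℕ} (hα : (polarization κ i j f).coeff α ≠ 0) :
    ∃ β, f.coeff β ≠ 0 ∧ ∑ p, α p * w p.1 + w j = ∑ p, β p * w p.1 + w i := by
  classical
  rw [polarization_apply, MvPolynomial.coeff_sum] at hα
  obtain ⟨b, -, hb⟩ := Finset.exists_ne_zero_of_sum_ne_zero hα
  rw [MvPolynomial.coeff_X_mul'] at hb
  split_ifs at hb with h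
  · rw [MvPolynomial.coeff_pderiv] at hb
    refine ⟨_, left_ne_zero_of_mul hb, ?_⟩
    have hle : Finsupp.single (i, b) 1 ≤ α := by
      rw [Finsupp.single_le_iff]
      exact Nat.one_le_iff_ne_zero.mpr (Finsupp.mem_support_iff.mp h)
    obtain ⟨γ, rfl⟩ := exists_add_of_le hle
    simp [add_mul, Finset.sum_add_distrib, Finsupp.single_apply]
    ring
  · exact absurd rfl hb

theorem totalDegree_polarization_le [Fintype ι] (i j : ι) (f : MvPolynomial (ι × κ) ℂ) :
    (polarization κ i j f).totalDegree ≤ f.totalDegree := by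
  refine Finset.sup_le fun α hα => ?_
  obtain ⟨β, hβ, h⟩ := exists_coeff_ne_zero_of_coeff_polarization_ne_zero (fun _ => 1)
    (MvPolynomial.mem_support_iff.mp hα)
  have h' := MvPolynomial.le_totalDegree (MvPolynomial.mem_support_iff.mpr hβ)
  rw [Finsupp.sum_fintype _ _ fun _ => rfl] at h' ⊢
  simp only [mul_one] at h
  omega

theorem derivation_det_eq_zero {A : Type*} [CommRing A] [Algebra ℂ A] (D : Derivation ℂ A A)
    {n : ℕ} (M : Matrix (Fin n) (Fin n) A) (h : ∀ a b, D (M a b) = 0) : D M.det = 0 := by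
  rw [Matrix.det_apply, map_sum]
  refine Finset.sum_eq_zero fun s _ => ?_
  have : D (∏ i, M (s i) i) = 0 := by
    refine Finset.prod_induction _ (fun x => D x = 0) (fun a b ha hb => ?_) ?_ fun i _ => h _ _
    · simp [ha, hb]
    · simp
  rcases Int.units_eq_one_or (Equiv.Perm.sign s) with h | h
  · rw [h, one_smul, this]
  · rw [h, Units.neg_smul, one_smul, map_neg, this, neg_zero]

theorem derivation_det_eq_det_updateRow {A : Type*} [CommRing A] [Algebra ℂ A]
    (D : Derivation ℂ A A) {n : ℕ} (M : Matrix (Fin n) (Fin n) A) (k : Fin n)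
    (h : ∀ a, a ≠ k → ∀ b, D (M a b) = 0) :
    D M.det = (M.updateRow k fun b => D (M k b)).det := by
  have hadj : ∀ b, D (M.adjugate b k) = 0 := fun b => by
    rw [Matrix.adjugate_apply]
    refine derivation_det_eq_zero D _ fun a c => ?_
    by_cases hak : a = k
    · subst hak
      rw [Matrix.updateRow_self, Pi.single_apply]
      split_ifs <;> simp
    · rw [Matrix.updateRow_ne hak, h a hak]
  have hadj' : ∀ b, (M.updateRow k fun b => D (M k b)).adjugate b k = M.adjugate b k := fun b => by
    rw [Matrix.adjugate_apply, Matrix.adjugate_apply, Matrix.updateRow_idem]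
  rw [Matrix.det_eq_sum_mul_adjugate_row M k, Matrix.det_eq_sum_mul_adjugate_row _ k, map_sum]
  refine Finset.sum_congr rfl fun b _ => ?_
  rw [hadj', Derivation.leibniz, hadj, Matrix.updateRow_self]
  simp [mul_comm]

theorem polarization_mem_maximalMinorsIdeal {m n : ℕ} (i j : Fin m) {f : GenRing m n}
    (hf : f ∈ maximalMinorsIdeal m n) :
    polarization (Fin n) i j f ∈ maximalMinorsIdeal m n := by
  refine Submodule.span_induction ?_ ?_ ?_ ?_ hf
  · rintro _ ⟨rows, hrows, rfl⟩
    by_cases h : ∃ k, rows k = j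
    · obtain ⟨k, hk⟩ := h
      rw [derivation_det_eq_det_updateRow _ _ k]
      · have : ((Matrix.of fun a b : Fin n => (MvPolynomial.X (rows a, b) : GenRing m n)).updateRow k
            fun b => polarization (Fin n) i j
              (Matrix.of (fun a b : Fin n => (MvPolynomial.X (rows a, b) : GenRing m n)) k b)) =
            Matrix.of fun a b : Fin n => MvPolynomial.X (Function.update rows k i a, b) := by
          ext1 a b
          by_cases hak : a = k
          · subst hak
            simp [polarization_X, hk]
          · simp [hak]
        rw [this]
        by_cases hinj : Function.Injective (Function.update rows k i)
        · exact Submodule.subset_span ⟨_, hinj, rfl⟩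
        · simp only [Function.Injective, not_forall] at hinj
          obtain ⟨a, b, hab, hne⟩ := hinj
          rw [Matrix.det_zero_of_row_eq hne (by ext1 c; simp [hab])]
          exact zero_mem _
      · intro a hak b
        rw [Matrix.of_apply, polarization_X, if_neg]
        exact fun h => hak (hrows (h.trans hk.symm))
    · rw [derivation_det_eq_zero]
      · exact zero_mem _
      · intro a b
        rw [Matrix.of_apply, polarization_X, if_neg fun h' => h ⟨a, h'⟩]
  · simp
  · intro x y _ _ hx hy
    rw [map_add]
    exact add_mem hx hy
  · intro a x hx' hx
    rw [smul_eq_mul, Derivation.leibniz]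
    exact add_mem (Ideal.mul_mem_left _ _ hx) (Ideal.mul_mem_right _ _ hx')

theorem map_conj_mem_maximalMinorsIdeal {m n : ℕ} {f : GenRing m n}
    (hf : f ∈ maximalMinorsIdeal m n) :
    MvPolynomial.map (starRingEnd ℂ) f ∈ maximalMinorsIdeal m n := by
  have h : maximalMinorsIdeal m n ≤
      (maximalMinorsIdeal m n).comap (MvPolynomial.map (starRingEnd ℂ)) := by
    refine Ideal.span_le.mpr ?_
    rintro _ ⟨rows, hrows, rfl⟩
    refine Submodule.subset_span ⟨rows, hrows, ?_⟩
    rw [RingHom.map_det]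
    congr 1
    ext1 a b
    simp
  exact h hf

/-- The ideal of polynomials vanishing on all matrices with a nonzero kernel. -/
def rankDeficientIdeal (m n : ℕ) : Ideal (GenRing m n) :=
  ⨅ (A : Matrix (Fin m) (Fin n) ℂ) (_ : ∃ u ≠ 0, A.mulVec u = 0),
    RingHom.ker (MvPolynomial.eval fun p => A p.1 p.2)

theorem mem_rankDeficientIdeal {m n : ℕ} {f : GenRing m n} :
    f ∈ rankDeficientIdeal m n ↔ ∀ A : Matrix (Fin m) (Fin n) ℂ, (∃ u ≠ 0, A.mulVec u = 0) →
      MvPolynomial.eval (fun p => A p.1 p.2) f = 0 := by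
  simp [rankDeficientIdeal, RingHom.mem_ker]

theorem maximalMinorsIdeal_le_rankDeficientIdeal (m n : ℕ) :
    maximalMinorsIdeal m n ≤ rankDeficientIdeal m n := by
  refine Ideal.span_le.mpr ?_
  rintro _ ⟨rows, hrows, rfl⟩
  rw [SetLike.mem_coe, mem_rankDeficientIdeal]
  rintro A ⟨u, hu, hA⟩
  rw [RingHom.map_det]
  refine Matrix.exists_mulVec_eq_zero_iff.mp ⟨u, hu, ?_⟩
  ext a
  simpa [Matrix.mulVec, dotProduct] using congrFun hA (rows a)

theorem polarization_mem_rankDeficientIdeal {m n : ℕ} {i j : Fin m} {f : GenRing m n}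
    (hf : f ∈ rankDeficientIdeal m n) :
    polarization (Fin n) i j f ∈ rankDeficientIdeal m n := by
  rw [mem_rankDeficientIdeal] at hf ⊢
  rintro A ⟨u, hu, hA⟩
  let φ : GenRing m n →ₐ[ℂ] Polynomial ℂ := MvPolynomial.aeval fun p =>
    Polynomial.C (A p.1 p.2) + Polynomial.X * Polynomial.C (if p.1 = j then A i p.2 else 0)
  have hφ : ∀ (s : ℂ) (g : GenRing m n), (φ g).eval s =
      MvPolynomial.eval (fun p => A p.1 p.2 + s * if p.1 = j then A i p.2 else 0) g := by
    intro s g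
    rw [← Polynomial.coe_evalRingHom, MvPolynomial.aeval_def, MvPolynomial.hom_eval₂,
      MvPolynomial.eval, MvPolynomial.coe_eval₂Hom]
    congr 1
    · ext
      simp
    · ext p
      rw [Polynomial.coe_evalRingHom, Polynomial.eval_add, Polynomial.eval_mul,
        Polynomial.eval_C, Polynomial.eval_C, Polynomial.eval_X]
  have h1 : φ f = 0 := by
    refine Polynomial.funext fun s => ?_
    have h := hf (fun a b => A a b + s * if a = j then A i b else 0) ⟨u, hu, ?_⟩
    · rw [Polynomial.eval_zero, ← h, hφ]
    · ext a
      have h0 := congrFun hA i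
      have h1 := congrFun hA a
      simp only [Matrix.mulVec, dotProduct, Pi.zero_apply] at h0 h1 ⊢
      by_cases ha : a = j
      · simp only [if_pos ha, add_mul, Finset.sum_add_distrib, mul_assoc, ← Finset.mul_sum, h0, h1,
          mul_zero, add_zero]
      · simp only [if_neg ha, mul_zero, add_zero, h1]
  have h2 : ∀ g : GenRing m n, MvPolynomial.eval (fun p => A p.1 p.2) (polarization (Fin n) i j g) =
      (Polynomial.derivative (φ g)).eval 0 := by
    intro g
    induction g using MvPolynomial.induction_on with
    | C a => simp [φ]
    | add p q hp hq => simp [hp, hq]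
    | mul_X p q hp =>
      obtain ⟨k, b⟩ := q
      have hX : φ (MvPolynomial.X (k, b)) =
          Polynomial.C (A k b) + Polynomial.X * Polynomial.C (if k = j then A i b else 0) :=
        MvPolynomial.aeval_X _ _
      have h0 : (φ p).eval 0 = MvPolynomial.eval (fun p => A p.1 p.2) p := by
        rw [hφ]
        simp only [zero_mul, add_zero]
      have hite : MvPolynomial.eval (fun p => A p.1 p.2)
          (if k = j then (MvPolynomial.X (i, b) : GenRing m n) else 0) =
          if k = j then A i b else 0 := by
        split_ifs <;> simp
      rw [Derivation.leibniz, polarization_X, smul_eq_mul, smul_eq_mul, map_add, map_mul, map_mul,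
        hp, map_mul, Polynomial.derivative_mul, hX, hite, MvPolynomial.eval_X, ← h0]
      simp only [Polynomial.derivative_add, Polynomial.derivative_mul, Polynomial.derivative_C,
        Polynomial.derivative_X, Polynomial.eval_add, Polynomial.eval_mul, Polynomial.eval_C,
        Polynomial.eval_X, Polynomial.eval_one, Polynomial.eval_zero]
      ring
  rw [h2, h1]
  simp

end Polarization

section SecondFundamentalTheorem

variable {m n : ℕ}

theorem det_top_minor_eq_rename (hmn : n ≤ m) :
    (Matrix.of fun a b : Fin n => (MvPolynomial.X (Fin.castLE hmn a, b) : GenRing m n)).det =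
      MvPolynomial.rename (Prod.map (Fin.castLE hmn) id)
        (Matrix.mvPolynomialX (Fin n) (Fin n) ℂ).det := by
  rw [AlgHom.map_det]
  congr 1
  ext1 a b
  simp

theorem pderiv_eq_zero_of_polarization_eq_zero (hmn : n ≤ m) (j : Fin m) {f : GenRing m n}
    (h : ∀ i : Fin n, polarization (Fin n) (Fin.castLE hmn i) j f = 0) (b : Fin n) :
    MvPolynomial.pderiv (j, b) f = 0 := by
  have hdet : (Matrix.of fun a b : Fin n =>
      (MvPolynomial.X (Fin.castLE hmn a, b) : GenRing m n)).det ≠ 0 := by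
    rw [det_top_minor_eq_rename, Ne, map_eq_zero_iff]
    · exact Matrix.det_mvPolynomialX_ne_zero _ _
    · exact MvPolynomial.rename_injective _
        ((Fin.castLE_injective hmn).prodMap Function.injective_id)
  have := Matrix.eq_zero_of_mulVec_eq_zero hdet (v := fun b => MvPolynomial.pderiv (j, b) f) (by
    ext1 i
    have := h i
    rw [polarization_apply] at this
    simpa [Matrix.mulVec, dotProduct] using this)
  exact congrFun this b

theorem notMem_vars_of_pderiv_eq_zero {σ : Type*} {f : MvPolynomial σ ℂ} {u : σ}
    (h : MvPolynomial.pderiv u f = 0) : u ∉ f.vars := by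
  classical
  rw [MvPolynomial.mem_vars_iff_mem_support]
  rintro ⟨α, hα, hu⟩
  have hle : Finsupp.single u 1 ≤ α := by
    rw [Finsupp.single_le_iff]
    exact Nat.one_le_iff_ne_zero.mpr (Finsupp.mem_support_iff.mp hu)
  obtain ⟨γ, rfl⟩ := exists_add_of_le hle
  have h2 := congrArg (MvPolynomial.coeff γ) h
  rw [MvPolynomial.coeff_pderiv, MvPolynomial.coeff_zero, add_comm γ] at h2
  rcases mul_eq_zero.mp h2 with h3 | h3
  · exact MvPolynomial.mem_support_iff.mp hα h3
  · exact Nat.cast_add_one_ne_zero (γ u) h3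

theorem mem_maximalMinorsIdeal_of_pderiv_eq_zero (hmn : n ≤ m) {f : GenRing m n}
    (hf : f ∈ rankDeficientIdeal m n)
    (h : ∀ j : Fin m, n ≤ j.val → ∀ b, MvPolynomial.pderiv (j, b) f = 0) :
    f ∈ maximalMinorsIdeal m n := by
  obtain ⟨g, rfl⟩ := MvPolynomial.exists_rename_eq_of_vars_subset_range f
    (Prod.map (Fin.castLE hmn) id : Fin n × Fin n → Fin m × Fin n)
    ((Fin.castLE_injective hmn).prodMap Function.injective_id) (by
      rintro ⟨j, b⟩ hjb
      by_cases hj : n ≤ j.val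
      · exact absurd hjb (notMem_vars_of_pderiv_eq_zero (h j hj b))
      · exact ⟨(⟨j.val, by omega⟩, b), rfl⟩)
  have hdvd : (Matrix.mvPolynomialX (Fin n) (Fin n) ℂ).det ∣ g := by
    refine det_mvPolynomialX_dvd_of_eval_eq_zero g fun A hA => ?_
    obtain ⟨u, hu, hAu⟩ := Matrix.exists_mulVec_eq_zero_iff.mpr hA
    have := mem_rankDeficientIdeal.mp hf
      (fun a b => if ha : a.val < n then A ⟨a.val, ha⟩ b else 0) ⟨u, hu, ?_⟩
    · rw [MvPolynomial.eval_rename] at this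
      rw [← this]
      congr 2
      ext ⟨a, b⟩
      simp
    · ext a
      by_cases ha : a.val < n
      · simpa [Matrix.mulVec, dotProduct, ha] using congrFun hAu ⟨a.val, ha⟩
      · simp [Matrix.mulVec, dotProduct, ha]
  obtain ⟨q, rfl⟩ := hdvd
  rw [map_mul, ← det_top_minor_eq_rename]
  exact Ideal.mul_mem_right _ _
    (Submodule.subset_span ⟨Fin.castLE hmn, Fin.castLE_injective hmn, rfl⟩)

/-- The polynomials of degree at most `d` in the ideal of maximal minors. -/
def maximalMinorsDegreeLE (m n d : ℕ) : Submodule ℂ (GenRing m n) :=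
  (maximalMinorsIdeal m n).restrictScalars ℂ ⊓
    MvPolynomial.restrictTotalDegree (Fin m × Fin n) ℂ d

instance (d : ℕ) : FiniteDimensional ℂ (maximalMinorsDegreeLE m n d) :=
  Submodule.finiteDimensional_inf_right _ _

theorem mem_maximalMinorsDegreeLE {d : ℕ} {f : GenRing m n} :
    f ∈ maximalMinorsDegreeLE m n d ↔ f ∈ maximalMinorsIdeal m n ∧ f.totalDegree ≤ d := by
  simp [maximalMinorsDegreeLE, MvPolynomial.mem_restrictTotalDegree]

theorem map_conj_mem_maximalMinorsDegreeLE {d : ℕ} {f : GenRing m n}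
    (hf : f ∈ maximalMinorsDegreeLE m n d) :
    MvPolynomial.map (starRingEnd ℂ) f ∈ maximalMinorsDegreeLE m n d := by
  rw [mem_maximalMinorsDegreeLE] at hf ⊢
  exact ⟨map_conj_mem_maximalMinorsIdeal hf.1,
    (MvPolynomial.totalDegree_le_of_support_subset (MvPolynomial.support_map_subset _ _)).trans hf.2⟩

theorem eq_zero_of_forall_polarization_eq_zero (hmn : n ≤ m) {d : ℕ} {f : GenRing m n}
    (hf : f ∈ rankDeficientIdeal m n) (hd : f.totalDegree ≤ d)
    (horth : ∀ h ∈ maximalMinorsDegreeLE m n d, fischer (Fin m × Fin n) h f = 0)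
    (hpol : ∀ (i : Fin n) (j : Fin m), n ≤ j.val →
      polarization (Fin n) (Fin.castLE hmn i) j f = 0) : f = 0 := by
  have hmem : f ∈ maximalMinorsIdeal m n :=
    mem_maximalMinorsIdeal_of_pderiv_eq_zero hmn hf fun j hj =>
      pderiv_eq_zero_of_polarization_eq_zero hmn j fun i => hpol i j hj
  exact eq_zero_of_fischer_conj_self f (horth _ (map_conj_mem_maximalMinorsDegreeLE
    (mem_maximalMinorsDegreeLE.mpr ⟨hmem, hd⟩)))

theorem eq_zero_of_mem_rankDeficientIdeal_of_fischer_eq_zero (hmn : n ≤ m) {d : ℕ} (k : ℕ) :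
    ∀ f : GenRing m n, f ∈ rankDeficientIdeal m n → f.totalDegree ≤ d →
      (∀ h ∈ maximalMinorsDegreeLE m n d, fischer (Fin m × Fin n) h f = 0) →
      (∀ α, f.coeff α ≠ 0 → ∑ p, α p * (if n ≤ p.1.val then 1 else 0) ≤ k) → f = 0 := by
  induction k with
  | zero =>
    intro f hf hd horth hk
    refine eq_zero_of_forall_polarization_eq_zero hmn hf hd horth fun i j hj => ?_
    ext α
    by_contra hα
    obtain ⟨β, hβ, h⟩ := exists_coeff_ne_zero_of_coeff_polarization_ne_zero
      (fun a : Fin m => if n ≤ a.val then 1 else 0) hα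
    have := hk β hβ
    simp only [if_pos hj, Fin.val_castLE, if_neg i.2.not_ge] at h
    omega
  | succ k ih =>
    intro f hf hd horth hk
    refine eq_zero_of_forall_polarization_eq_zero hmn hf hd horth fun i j hj => ?_
    refine ih _ (polarization_mem_rankDeficientIdeal hf)
      ((totalDegree_polarization_le _ _ _).trans hd) (fun h hh => ?_) fun α hα => ?_
    · rw [fischer_comm, fischer_polarization, fischer_comm]
      rw [mem_maximalMinorsDegreeLE] at hh
      exact horth _ (mem_maximalMinorsDegreeLE.mpr
        ⟨polarization_mem_maximalMinorsIdeal _ _ hh.1,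
          (totalDegree_polarization_le _ _ _).trans hh.2⟩)
    · obtain ⟨β, hβ, h⟩ := exists_coeff_ne_zero_of_coeff_polarization_ne_zero
        (fun a : Fin m => if n ≤ a.val then 1 else 0) hα
      have := hk β hβ
      simp only [if_pos hj, Fin.val_castLE, if_neg i.2.not_ge] at h
      omega

theorem rankDeficientIdeal_le_maximalMinorsIdeal (hmn : n ≤ m) :
    rankDeficientIdeal m n ≤ maximalMinorsIdeal m n := by
  intro f hf
  obtain ⟨g, hg, horth⟩ := exists_mem_fischer_sub_eq_zero
    (maximalMinorsDegreeLE m n f.totalDegree)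
    (fun _ => map_conj_mem_maximalMinorsDegreeLE) f
  rw [mem_maximalMinorsDegreeLE] at hg
  have h0 : f - g = 0 :=
    eq_zero_of_mem_rankDeficientIdeal_of_fischer_eq_zero hmn
      ((f - g).support.sup fun α => ∑ p, α p * (if n ≤ p.1.val then 1 else 0)) _
      (sub_mem hf (maximalMinorsIdeal_le_rankDeficientIdeal m n hg.1))
      ((MvPolynomial.totalDegree_sub _ _).trans (max_le le_rfl hg.2)) horth
      fun α hα => Finset.le_sup (f := fun α : Fin m × Fin n →₀ ℕ =>
        ∑ p, α p * (if n ≤ p.1.val then 1 else 0)) (MvPolynomial.mem_support_iff.mpr hα)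
  rw [sub_eq_zero.mp h0]
  exact hg.1

end SecondFundamentalTheorem

section MinorsAnnihilate

variable {m n : ℕ}

theorem minor_smul_genK_eq_zero (rows : Fin n → Fin m) (x : genK m n) :
    (Matrix.of fun a b : Fin n => (MvPolynomial.X (rows a, b) : GenRing m n)).det • x = 0 := by
  obtain ⟨φ, rfl⟩ := Submodule.mkQ_surjective _ x
  rw [← map_smul, Submodule.mkQ_apply, Submodule.Quotient.mk_eq_zero]
  set M := Matrix.of fun a b : Fin n => (MvPolynomial.X (rows a, b) : GenRing m n) with hM
  refine ⟨φ ∘ₗ M.adjugate.mulVecLin ∘ₗ LinearMap.funLeft _ _ rows, LinearMap.ext fun u => ?_⟩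
  have h : LinearMap.funLeft (GenRing m n) (GenRing m n) rows (genMap m n u) = M.mulVec u := by
    ext1 a
    simp [genMap, hM, Matrix.mulVec, dotProduct, LinearMap.funLeft_apply]
  rw [LinearMap.dualMap_apply, LinearMap.comp_apply, LinearMap.comp_apply, h,
    Matrix.mulVecLin_apply, Matrix.mulVec_mulVec, Matrix.adjugate_mul, Matrix.smul_mulVec,
    Matrix.one_mulVec, map_smul, LinearMap.smul_apply]

theorem smul_symPow_eq_zero {R N : Type*} [CommRing R] [AddCommGroup N] [Module R N] {k : ℕ}
    (hk : k ≠ 0) (r : R) (h : ∀ x : N, r • x = 0) (y : SymPow R N k) : r • y = 0 := by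
  obtain ⟨z, rfl⟩ := Submodule.mkQ_surjective _ y
  rw [← map_smul]
  suffices h : r • z = 0 by rw [h, map_zero]
  have : r • (LinearMap.id : (⨂[R]^k N) →ₗ[R] ⨂[R]^k N) = 0 := by
    refine PiTensorProduct.ext (MultilinearMap.ext fun v => ?_)
    have i : Fin k := ⟨0, Nat.pos_of_ne_zero hk⟩
    have hv := (PiTensorProduct.tprod R).map_update_smul v i r (v i)
    rw [h, MultilinearMap.map_update_zero, Function.update_eq_self] at hv
    simpa using hv.symm
  exact LinearMap.congr_fun this z

/-- If an alternating map `φ` in `c` arguments kills the vectors `w b`, with `c + n` exceeding the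
rank of the ambient free module, then `φ v` is killed by every alternating function of `w`. -/
theorem alternatingMap_smul_eq_zero {R P : Type*} [CommRing R] [AddCommGroup P] [Module R P]
    {m n c : ℕ} (hc : m < c + n) (φ : (Fin m → R) [⋀^Fin c]→ₗ[R] P)
    (δ : (Fin m → R) [⋀^Fin n]→ₗ[R] R) (w : Fin n → Fin m → R)
    (hw : ∀ (v : Fin c → Fin m → R) (a : Fin c) (b : Fin n), v a = w b → φ v = 0)
    (v : Fin c → Fin m → R) : δ w • φ v = 0 := by
  have hzero : φ.domCoprod δ = 0 := by
    refine Module.Basis.ext_alternating (Pi.basisFun R (Fin m)) fun i hi => ?_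
    have := Fintype.card_le_of_injective i hi
    simp only [Fintype.card_sum, Fintype.card_fin] at this
    omega
  have key : ∀ σ : Equiv.Perm.ModSumCongr (Fin c) (Fin n), σ ≠ Quotient.mk'' 1 →
      AlternatingMap.domCoprod.summand φ δ σ (Sum.elim v w) = 0 := by
    intro σ hσ
    induction σ using Quotient.inductionOn' with | _ σ
    have hex : ∃ a b, σ (Sum.inl a) = Sum.inr b := by
      by_contra! hcon
      refine hσ (Quotient.sound' ?_)
      rw [QuotientGroup.leftRel_apply, mul_one]
      refine inv_mem (Equiv.Perm.mem_sumCongrHom_range_of_perm_mapsTo_inl ?_)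
      rintro _ ⟨a, rfl⟩
      rcases h : σ (Sum.inl a) with b | b
      · exact ⟨b, rfl⟩
      · exact absurd h (hcon a b)
    obtain ⟨a, b, hab⟩ := hex
    have hφ : φ (fun i => Sum.elim v w (σ (Sum.inl i))) = 0 := hw _ a b (by rw [hab, Sum.elim_inr])
    rw [AlternatingMap.domCoprod.summand_mk'', smul_apply,
      MultilinearMap.domDomCongr_apply, MultilinearMap.domCoprod_apply,
      AlternatingMap.coe_multilinearMap, hφ, TensorProduct.zero_tmul, smul_zero]
  have h := congrArg (fun ψ => ψ (Sum.elim v w)) hzero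
  simp only [AlternatingMap.domCoprod_apply, sum_apply, AlternatingMap.zero_apply] at h
  rw [Fintype.sum_eq_single _ key, AlternatingMap.domCoprod.summand_mk''] at h
  simpa using congrArg (TensorProduct.rid R P) h

theorem minor_smul_exteriorPower_genCoker_eq_zero {c : ℕ} (hc : m < c + n)
    (rows : Fin n → Fin m) (y : ⋀[GenRing m n]^c (genCoker m n)) :
    (Matrix.of fun a b : Fin n => (MvPolynomial.X (rows a, b) : GenRing m n)).det • y = 0 := by
  set M := Matrix.of fun a b : Fin n => (MvPolynomial.X (rows a, b) : GenRing m n) with hM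
  have : M.det • (LinearMap.id : (⋀[GenRing m n]^c (genCoker m n)) →ₗ[GenRing m n] _) = 0 := by
    refine exteriorPower.linearMap_ext (AlternatingMap.ext fun v => ?_)
    choose v' hv' using fun a => Submodule.mkQ_surjective _ (v a)
    obtain rfl : (fun a => Submodule.mkQ _ (v' a)) = v := funext hv'
    have h := alternatingMap_smul_eq_zero hc
      ((exteriorPower.ιMulti (GenRing m n) c).compLinearMap
        (Submodule.mkQ (LinearMap.range (genMap m n))))
      (Matrix.detRowAlternating.compLinearMap (LinearMap.funLeft _ _ rows))
      (fun b => genMap m n (Pi.single b 1)) ?_ v'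
    · have hdet : Matrix.detRowAlternating.compLinearMap
          (LinearMap.funLeft (GenRing m n) (GenRing m n) rows)
          (fun b => genMap m n (Pi.single b 1)) = M.det := by
        rw [← Matrix.det_transpose M]
        change Matrix.det _ = _
        congr 1
        ext1 a b
        simp [genMap, hM, LinearMap.funLeft_apply]
      rw [hdet] at h
      exact h
    · intro v a b hab
      rw [AlternatingMap.compLinearMap_apply]
      refine AlternatingMap.map_coord_zero _ a ?_
      rw [hab, Submodule.mkQ_apply, Submodule.Quotient.mk_eq_zero]
      exact LinearMap.mem_range_self _ _
  exact LinearMap.congr_fun this y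

theorem maximalMinorsIdeal_le_annihilator (c : ℕ) (hc : m < c + n) (j : ℕ) (hj : j ≤ c) :
    maximalMinorsIdeal m n ≤ Module.annihilator (GenRing m n)
        ((SymPow (GenRing m n) (genK m n) (c - j)) ⊗[GenRing m n]
          (⋀[GenRing m n]^j (genCoker m n))) := by
  refine Ideal.span_le.mpr ?_
  rintro _ ⟨rows, -, rfl⟩
  rw [SetLike.mem_coe, Module.mem_annihilator]
  intro z
  induction z using TensorProduct.induction_on with
  | zero => rw [smul_zero]
  | add x y hx hy => rw [smul_add, hx, hy, add_zero]
  | tmul x y =>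
    rcases hj.eq_or_lt with rfl | hlt
    · rw [← TensorProduct.tmul_smul, minor_smul_exteriorPower_genCoker_eq_zero hc,
        TensorProduct.tmul_zero]
    · rw [TensorProduct.smul_tmul',
        smul_symPow_eq_zero (Nat.sub_ne_zero_of_lt hlt) _ (minor_smul_genK_eq_zero rows),
        TensorProduct.zero_tmul]

end MinorsAnnihilate

section Specialization

variable {R S : Type*} [CommRing R] [CommRing S] [Algebra R S]

theorem exists_symPow_functional_eq_one {N : Type*} [AddCommGroup N] [Module R N] (k : ℕ)
    (ℓ : N →ₗ[R] S) (x : N) (hx : ℓ x = 1) :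
    ∃ (F : SymPow R N k →ₗ[R] S) (y : SymPow R N k), F y = 1 := by
  let G : (⨂[R]^k N) →ₗ[R] S :=
    PiTensorProduct.lift ((MultilinearMap.mkPiAlgebra R (Fin k) S).compLinearMap fun _ => ℓ)
  have hG : SymPow.rel R N k ≤ LinearMap.ker G := by
    refine Submodule.span_le.mpr ?_
    rintro _ ⟨v, e, rfl⟩
    rw [SetLike.mem_coe, LinearMap.mem_ker, map_sub, sub_eq_zero]
    simpa [G] using (Equiv.prod_comp e fun i => ℓ (v i)).symm
  refine ⟨(SymPow.rel R N k).liftQ G hG, Submodule.mkQ _ (PiTensorProduct.tprod R fun _ => x), ?_⟩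
  rw [Submodule.mkQ_apply, Submodule.liftQ_apply]
  simp [G, hx]

theorem exists_exteriorPower_functional_eq_one {P : Type*} [AddCommGroup P] [Module R P] {j : ℕ}
    (W : P →ₗ[R] (Fin j → S)) (hW : Function.Surjective W) :
    ∃ (F : (⋀[R]^j P) →ₗ[R] S) (y : ⋀[R]^j P), F y = 1 := by
  choose v hv using fun a => hW (Pi.single a 1)
  refine ⟨exteriorPower.alternatingMapLinearEquiv
    (({ Matrix.detRowAlternating.toMultilinearMap.restrictScalars R with
        map_eq_zero_of_eq' := (Matrix.detRowAlternating (R := S)).map_eq_zero_of_eq' } :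
      (Fin j → S) [⋀^Fin j]→ₗ[R] S).compLinearMap W),
    exteriorPower.ιMulti R j v, ?_⟩
  rw [exteriorPower.alternatingMapLinearEquiv_apply_ιMulti]
  change Matrix.det (fun a => W (v a)) = 1
  rw [← Matrix.det_one (n := Fin j) (R := S)]
  congr 1
  ext a b
  rw [hv, Matrix.one_eq_pi_single]

theorem algebraMap_eq_zero_of_mem_annihilator_tensorProduct {M N : Type*} [AddCommGroup M]
    [Module R M] [AddCommGroup N] [Module R N] (F : M →ₗ[R] S) (x : M) (hx : F x = 1)
    (G : N →ₗ[R] S) (y : N) (hy : G y = 1) {f : R}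
    (hf : f ∈ Module.annihilator R (M ⊗[R] N)) : algebraMap R S f = 0 := by
  have h := congrArg (LinearMap.mul' R S ∘ₗ TensorProduct.map F G)
    (Module.mem_annihilator.mp hf (x ⊗ₜ y))
  simpa [hx, hy, Algebra.algebraMap_eq_smul_one] using h

theorem exists_surjective_comp_eq_zero {K : Type*} [Field K] {m n j : ℕ} (hj : j + n ≤ m + 1)
    (A : Matrix (Fin m) (Fin n) K) (hA : ∃ u ≠ 0, A.mulVec u = 0) :
    ∃ W : (Fin m → K) →ₗ[K] (Fin j → K), Function.Surjective W ∧ W ∘ₗ A.mulVecLin = 0 := by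
  obtain ⟨u, hu, hAu⟩ := hA
  set Q := (Fin m → K) ⧸ LinearMap.range A.mulVecLin
  have hker : 0 < Module.finrank K (LinearMap.ker A.mulVecLin) := by
    rw [Module.finrank_pos_iff_exists_ne_zero]
    exact ⟨⟨u, by simpa using hAu⟩, fun h => hu (congrArg Subtype.val h)⟩
  have h1 := LinearMap.finrank_range_add_finrank_ker A.mulVecLin
  have h2 := Submodule.finrank_quotient_add_finrank (LinearMap.range A.mulVecLin)
  rw [Module.finrank_fin_fun] at h1 h2
  have hle : j ≤ Module.finrank K Q := by
    change Module.finrank K Q + _ = _ at h2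
    omega
  refine ⟨LinearMap.funLeft K K (Fin.castLE hle) ∘ₗ
    (Module.finBasis K Q).equivFun.toLinearMap ∘ₗ Submodule.mkQ (LinearMap.range A.mulVecLin), ?_, ?_⟩
  · exact (LinearMap.funLeft_surjective_of_injective K K _ (Fin.castLE_injective hle)).comp
      ((Module.finBasis K Q).equivFun.surjective.comp (Submodule.mkQ_surjective _))
  · rw [LinearMap.comp_assoc, LinearMap.comp_assoc, LinearMap.range_mkQ_comp, LinearMap.comp_zero,
      LinearMap.comp_zero]

variable {m n : ℕ}

theorem exists_genK_functional_eq_one {K : Type*} [Field K] [Algebra (GenRing m n) K]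
    (u : Fin n → K) (hu : u ≠ 0)
    (hAu : ∀ i, ∑ b, algebraMap (GenRing m n) K (MvPolynomial.X (i, b)) * u b = 0)
    (hsurj : Function.Surjective (algebraMap (GenRing m n) K)) :
    ∃ (ℓ : genK m n →ₗ[GenRing m n] K) (x : genK m n), ℓ x = 1 := by
  let L : Module.Dual (GenRing m n) (Fin n → GenRing m n) →ₗ[GenRing m n] K :=
    ∑ b, LinearMap.toSpanSingleton (GenRing m n) K (u b) ∘ₗ
      Module.Dual.eval (GenRing m n) (Fin n → GenRing m n) (Pi.single b 1)
  have hL : ∀ φ, L φ = ∑ b, algebraMap (GenRing m n) K (φ (Pi.single b 1)) * u b := fun φ => by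
    simp [L, Algebra.smul_def]
  have hker : LinearMap.range (genMap m n).dualMap ≤ LinearMap.ker L := by
    rintro _ ⟨ψ, rfl⟩
    rw [LinearMap.mem_ker, hL]
    have hψ : ∀ b, (genMap m n).dualMap ψ (Pi.single b 1) =
        ∑ i, MvPolynomial.X (i, b) * ψ (Pi.single i 1) := fun b => by
      rw [LinearMap.dualMap_apply, LinearMap.pi_apply_eq_sum_univ ψ]
      refine Finset.sum_congr rfl fun i _ => ?_
      rw [smul_eq_mul]
      congr 2
      · simp [genMap]
      · ext1 k
        simp [Pi.single_apply, eq_comm]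
    simp only [hψ, map_sum, map_mul, Finset.sum_mul]
    rw [Finset.sum_comm]
    refine Finset.sum_eq_zero fun i _ => ?_
    simp only [mul_right_comm _ _ (u _)]
    rw [← Finset.sum_mul, hAu, zero_mul]
  obtain ⟨b, hb⟩ := Function.ne_iff.mp hu
  obtain ⟨r, hr⟩ := hsurj (u b)⁻¹
  refine ⟨Submodule.liftQ _ L hker, Submodule.mkQ _ (r • LinearMap.proj b), ?_⟩
  rw [Submodule.mkQ_apply, Submodule.liftQ_apply, hL]
  rw [Finset.sum_eq_single b (fun a _ ha => by simp [ha]) (by simp)]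
  simpa [hr] using inv_mul_cancel₀ hb

theorem exists_genCoker_surjective {K : Type*} [Field K] [Algebra (GenRing m n) K] {j : ℕ}
    (hj : j + n ≤ m + 1)
    (hA : ∃ u : Fin n → K, u ≠ 0 ∧
      ∀ i, ∑ b, algebraMap (GenRing m n) K (MvPolynomial.X (i, b)) * u b = 0)
    (hsurj : Function.Surjective (algebraMap (GenRing m n) K)) :
    ∃ W : genCoker m n →ₗ[GenRing m n] (Fin j → K), Function.Surjective W := by
  obtain ⟨u, hu, hAu⟩ := hA
  obtain ⟨W, hW, hWA⟩ := exists_surjective_comp_eq_zero hj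
    (Matrix.of fun i b => algebraMap (GenRing m n) K (MvPolynomial.X (i, b)))
    ⟨u, hu, funext fun i => by simpa [Matrix.mulVec, dotProduct] using hAu i⟩
  let V : (Fin m → GenRing m n) →ₗ[GenRing m n] (Fin j → K) :=
    W.restrictScalars (GenRing m n) ∘ₗ (Algebra.linearMap (GenRing m n) K).compLeft (Fin m)
  have hker : LinearMap.range (genMap m n) ≤ LinearMap.ker V := by
    rintro _ ⟨x, rfl⟩
    rw [LinearMap.mem_ker]
    have := LinearMap.congr_fun hWA fun b => algebraMap (GenRing m n) K (x b)
    rw [LinearMap.comp_apply, LinearMap.zero_apply] at this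
    rw [← this]
    change W _ = W _
    congr 1
    ext i
    simp [genMap, Matrix.mulVec, dotProduct]
  refine ⟨Submodule.liftQ _ V hker, fun y => ?_⟩
  obtain ⟨z, rfl⟩ := hW y
  choose z' hz' using fun i => hsurj (z i)
  refine ⟨Submodule.mkQ _ z', ?_⟩
  rw [Submodule.mkQ_apply, Submodule.liftQ_apply]
  change W _ = W _
  congr 1
  ext i
  exact hz' i

theorem annihilator_le_rankDeficientIdeal {c j : ℕ} (hj : j + n ≤ m + 1) :
    Module.annihilator (GenRing m n)
        ((SymPow (GenRing m n) (genK m n) (c - j)) ⊗[GenRing m n]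
          (⋀[GenRing m n]^j (genCoker m n))) ≤ rankDeficientIdeal m n := by
  intro f hf
  rw [mem_rankDeficientIdeal]
  rintro A ⟨u, hu, hAu⟩
  let _ : Algebra (GenRing m n) ℂ := (MvPolynomial.eval fun p => A p.1 p.2).toAlgebra
  have hmap : ∀ g, algebraMap (GenRing m n) ℂ g = MvPolynomial.eval (fun p => A p.1 p.2) g :=
    fun _ => rfl
  have hsurj : Function.Surjective (algebraMap (GenRing m n) ℂ) :=
    fun z => ⟨MvPolynomial.C z, by rw [hmap, MvPolynomial.eval_C]⟩
  have hu' : ∀ i, ∑ b, algebraMap (GenRing m n) ℂ (MvPolynomial.X (i, b)) * u b = 0 := fun i => by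
    simpa [hmap, Matrix.mulVec, dotProduct] using congrFun hAu i
  obtain ⟨ℓ, x, hx⟩ := exists_genK_functional_eq_one u hu hu' hsurj
  obtain ⟨W, hW⟩ := exists_genCoker_surjective hj ⟨u, hu, hu'⟩ hsurj
  obtain ⟨F, y, hy⟩ := exists_symPow_functional_eq_one (c - j) ℓ x hx
  obtain ⟨G, z, hz⟩ := exists_exteriorPower_functional_eq_one W hW
  exact algebraMap_eq_zero_of_mem_annihilator_tensorProduct F y hy G z hz hf

end Specialization

/-- For `m ≥ n ≥ 1`, `c = m - n + 1` and `0 ≤ j ≤ c`, the annihilator in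
`R` of `Sym^{c-j}_R K ⊗_R ⋀^j_R coKer` equals the ideal `I_n(T)` of maximal minors of the
generic matrix `T`. -/
theorem annihilator_symK_tensor_wedge_coker_eq_maximalMinors
    (m n : ℕ) (hn : 1 ≤ n) (hmn : n ≤ m) (c : ℕ) (hc : c = m - n + 1)
    (j : ℕ) (hj : j ≤ c) :
    Module.annihilator (GenRing m n)
        ((SymPow (GenRing m n) (genK m n) (c - j)) ⊗[GenRing m n]
          (⋀[GenRing m n]^j (genCoker m n)))
      = maximalMinorsIdeal m n := by
  refine le_antisymm ?_ (maximalMinorsIdeal_le_annihilator c (by omega) j hj)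
  exact (annihilator_le_rankDeficientIdeal (by omega)).trans
    (rankDeficientIdeal_le_maximalMinorsIdeal hmn)
end
end

section
/- Let V, W be complex vector spaces of dimensions n and m with n ≤ m, and let f : V → W be a ℂ-linear map. Then the linear span of the two families { f ∘ a : a ∈ Hom(Sym^{m−n}V, V) } and { b ⊙ f : b ∈ Hom(Sym^{m−n−1}V, 𝔰𝔩(W)) } inside Hom(Sym^{m−n}V, W) is equal to the subspace { η ∈ Hom(Sym^{m−n}V, W) : η(Sym^{m−n}(ker f)) ⊆ im f }, where Sym^{m−n}(ker f) denotes the image of the natural map Sym^{m−n}(ker f) → Sym^{m−n}V. -/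
open scoped TensorProduct

noncomputable section

/-- The product `v₁ ⋯ v_k` of a family of vectors, as an element of `Sym^k N`. -/
def SymPow.mk (R : Type*) [CommRing R] {N : Type*} [AddCommGroup N] [Module R N]
    (k : ℕ) (v : Fin k → N) : SymPow R N k :=
  Submodule.Quotient.mk (PiTensorProduct.tprod R v)

/-- For `i : Fin k`, the increasing bijection `Fin (k-1) → Fin k ∖ {i}`, used to omit the
`i`-th entry of a family. -/
def omitAt {k : ℕ} (i : Fin k) (a : Fin (k - 1)) : Fin k :=
  ⟨if (a : ℕ) < (i : ℕ) then (a : ℕ) else (a : ℕ) + 1,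
    by have ha := a.isLt; have hi := i.isLt; split <;> omega⟩

namespace SymPow

section

variable {R : Type*} [CommRing R] {N : Type*} [AddCommGroup N] [Module R N]
  {M : Type*} [AddCommGroup M] [Module R M] {k : ℕ}

variable (R N k) in
/-- The product `v₁ ⋯ v_k` as a multilinear map in the factors. -/
def mkMultilinear : MultilinearMap R (fun _ : Fin k => N) (SymPow R N k) :=
  (rel R N k).mkQ.compMultilinearMap (PiTensorProduct.tprod R)

theorem mkMultilinear_apply (v : Fin k → N) : mkMultilinear R N k v = mk R k v := rfl

theorem mk_comp_perm (v : Fin k → N) (e : Equiv.Perm (Fin k)) :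
    mk R k (v ∘ e) = mk R k v :=
  ((Submodule.Quotient.eq (rel R N k)).2 (Submodule.subset_span ⟨v, e, rfl⟩)).symm

theorem span_range_mk : Submodule.span R (Set.range (mk R k : (Fin k → N) → _)) = ⊤ := by
  have h : (mk R k : (Fin k → N) → SymPow R N k)
      = (rel R N k).mkQ ∘ PiTensorProduct.tprod R := rfl
  rw [h, Set.range_comp, Submodule.span_image, PiTensorProduct.span_tprod_eq_top,
    Submodule.map_top, Submodule.range_mkQ]

theorem hom_ext {g h : SymPow R N k →ₗ[R] M} (H : ∀ v, g (mk R k v) = h (mk R k v)) : g = h :=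
  LinearMap.ext_on_range span_range_mk H

/-- The linear map on `Sym^k N` induced by a symmetric multilinear map. -/
def lift (g : MultilinearMap R (fun _ : Fin k => N) M)
    (hg : ∀ (v : Fin k → N) (e : Equiv.Perm (Fin k)), g (v ∘ e) = g v) :
    SymPow R N k →ₗ[R] M :=
  (rel R N k).liftQ (PiTensorProduct.lift g) <| by
    rw [rel, Submodule.span_le]
    rintro _ ⟨v, e, rfl⟩
    simp [hg]

theorem lift_mk (g : MultilinearMap R (fun _ : Fin k => N) M)
    (hg : ∀ (v : Fin k → N) (e : Equiv.Perm (Fin k)), g (v ∘ e) = g v) (v : Fin k → N) :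
    lift g hg (mk R k v) = g v :=
  (Submodule.liftQ_apply _ _ _).trans (PiTensorProduct.lift.tprod v)

theorem curryLeft_comp_perm (x : N) (v : Fin k → N) (e : Equiv.Perm (Fin k)) :
    (mkMultilinear R N (k + 1)).curryLeft x (v ∘ e)
      = (mkMultilinear R N (k + 1)).curryLeft x v := by
  simp only [MultilinearMap.curryLeft_apply, mkMultilinear_apply]
  rw [← mk_comp_perm (Fin.cons x v) (Equiv.Perm.decomposeFin.symm (0, e))]
  congr 1
  ext i
  refine Fin.cases ?_ (fun i => ?_) i <;> simp

/-- Multiplication `N × Sym^k N → Sym^{k+1} N`. -/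
def mul : N →ₗ[R] SymPow R N k →ₗ[R] SymPow R N (k + 1) where
  toFun x := lift ((mkMultilinear R N (k + 1)).curryLeft x) (curryLeft_comp_perm x)
  map_add' x y := hom_ext fun v => by simp [lift_mk]
  map_smul' c x := hom_ext fun v => by simp [lift_mk]

theorem mul_mk (x : N) (v : Fin k → N) :
    mul x (mk R k v) = mk R (k + 1) (Fin.cons x v : Fin (k + 1) → N) :=
  lift_mk _ (curryLeft_comp_perm x) v

theorem mul_mk_removeNth (x : N) (v : Fin (k + 1) → N) (i : Fin (k + 1)) :
    mul x (mk R k (i.removeNth v)) = mk R (k + 1) (Function.update v i x) := by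
  rw [mul_mk, ← mk_comp_perm (Function.update v i x) i.cycleRange.symm,
    ← Fin.cons_removeNth_eq_comp_cycleRange_symm]
  simp

/-- The derivation of the symmetric algebra extending `P`, in degree `k`. -/
def derivation (P : N →ₗ[R] N) : SymPow R N k →ₗ[R] SymPow R N k :=
  lift (∑ i, (mkMultilinear R N k).compLinearMap (Function.update (fun _ => LinearMap.id) i P))
    fun v e => by
      simp only [sum_apply, MultilinearMap.compLinearMap_apply,
        mkMultilinear_apply]
      refine Fintype.sum_equiv e _ _ fun i => ?_
      refine Eq.trans ?_ (mk_comp_perm _ e)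
      congr 1
      ext j
      by_cases h : j = i
      · subst h; simp
      · simp [h]

theorem derivation_mk (P : N →ₗ[R] N) (v : Fin k → N) :
    derivation P (mk R k v) = ∑ i, mk R k (Function.update v i (P (v i))) := by
  rw [derivation, lift_mk]
  simp only [sum_apply, MultilinearMap.compLinearMap_apply, mkMultilinear_apply]
  refine Finset.sum_congr rfl fun i _ => ?_
  congr 1
  ext j
  by_cases h : j = i
  · subst h; simp
  · simp [h]

theorem derivation_mk_piecewise {P : N →ₗ[R] N} (hP : ∀ x, P (P x) = P x) (v : Fin k → N)
    (s : Finset (Fin k)) :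
    derivation P (mk R k (s.piecewise (fun i => P (v i)) fun i => v i - P (v i)))
      = (s.card : R) • mk R k (s.piecewise (fun i => P (v i)) fun i => v i - P (v i)) := by
  set w := s.piecewise (fun i => P (v i)) fun i => v i - P (v i) with hw
  have key : ∀ i, mk R k (Function.update w i (P (w i))) = if i ∈ s then mk R k w else 0 := by
    intro i
    split_ifs with hi
    · have : P (w i) = w i := by simp [hw, hi, hP]
      rw [this, Function.update_eq_self]
    · have : P (w i) = 0 := by simp [hw, hi, hP]
      rw [this, ← mkMultilinear_apply]
      exact MultilinearMap.map_update_zero _ _ _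
  simp [derivation_mk, key, Nat.cast_smul_eq_nsmul]

end

theorem ker_derivation_le {𝕜 N : Type*} [Field 𝕜] [CharZero 𝕜] [AddCommGroup N] [Module 𝕜 N]
    {k : ℕ} {P : N →ₗ[𝕜] N} (hP : ∀ x, P (P x) = P x) :
    LinearMap.ker (derivation P : SymPow 𝕜 N k →ₗ[𝕜] _)
      ≤ Submodule.span 𝕜 {x | ∃ v : Fin k → N, (∀ i, P (v i) = 0) ∧ x = mk 𝕜 k v} := by
  set S := Submodule.span 𝕜 {x | ∃ v : Fin k → N, (∀ i, P (v i) = 0) ∧ x = mk 𝕜 k v} with hS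
  let D : Module.End 𝕜 (SymPow 𝕜 N k) := derivation P
  have hS_le : S ≤ D.eigenspace 0 := by
    rw [hS, Submodule.span_le]
    rintro _ ⟨v, hv, rfl⟩
    rw [SetLike.mem_coe, Module.End.mem_eigenspace_iff, zero_smul]
    refine (derivation_mk P v).trans (Finset.sum_eq_zero fun i _ => ?_)
    rw [hv i, ← mkMultilinear_apply]
    exact MultilinearMap.map_update_zero _ _ _
  have htop : S ⊔ ⨆ c ≠ (0 : 𝕜), D.eigenspace c = ⊤ := by
    rw [eq_top_iff, ← span_range_mk, Submodule.span_le]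
    rintro _ ⟨v, rfl⟩
    have hv : v = (fun i => P (v i)) + fun i => v i - P (v i) := by ext i; simp
    rw [hv, ← mkMultilinear_apply, MultilinearMap.map_add_univ]
    refine Submodule.sum_mem _ fun s _ => ?_
    rw [mkMultilinear_apply]
    rcases s.eq_empty_or_nonempty with rfl | hs
    · refine Submodule.mem_sup_left (Submodule.subset_span ⟨_, fun i => ?_, rfl⟩)
      simp [hP]
    · refine Submodule.mem_sup_right (Submodule.mem_iSup_of_mem (s.card : 𝕜)
        (Submodule.mem_iSup_of_mem (by simpa using hs.ne_empty) ?_))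
      rw [Module.End.mem_eigenspace_iff]
      exact derivation_mk_piecewise hP v s
  intro x hx
  obtain ⟨y, hy, z, hz, rfl⟩ := Submodule.mem_sup.1 (htop.ge (Submodule.mem_top (x := x)))
  have hx0 : y + z ∈ D.eigenspace 0 := by
    rwa [Module.End.mem_eigenspace_iff, zero_smul]
  have hz0 : z ∈ D.eigenspace 0 := by
    simpa using Submodule.sub_mem _ hx0 (hS_le hy)
  have hz_zero : z = 0 :=
    Submodule.disjoint_def.1 (D.eigenspaces_iSupIndep 0) z hz0 hz
  simpa [hz_zero] using hy

end SymPow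

theorem LinearMap.exists_comp_eq_of_ker_le_ker {𝕜 M N L : Type*} [Field 𝕜]
    [AddCommGroup M] [Module 𝕜 M] [AddCommGroup N] [Module 𝕜 N] [AddCommGroup L] [Module 𝕜 L]
    (g : M →ₗ[𝕜] N) (h : M →ₗ[𝕜] L) (hgh : ker g ≤ ker h) : ∃ l : N →ₗ[𝕜] L, l ∘ₗ g = h := by
  obtain ⟨l, hl⟩ := ((ker g).liftQ h hgh ∘ₗ g.quotKerEquivRange.symm.toLinearMap).exists_extend
  refine ⟨l, LinearMap.ext fun x => ?_⟩
  have := LinearMap.congr_fun hl (g.rangeRestrict x)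
  have hx : g.rangeRestrict x = g.quotKerEquivRange (Submodule.Quotient.mk x) := rfl
  rw [hx] at this
  simpa using this

theorem LinearMap.exists_reflexive_pseudoinverse {𝕜 M N : Type*} [Field 𝕜]
    [AddCommGroup M] [Module 𝕜 M] [AddCommGroup N] [Module 𝕜 N] (f : M →ₗ[𝕜] N) :
    ∃ g : N →ₗ[𝕜] M, (∀ x, f (g (f x)) = f x) ∧ ∀ y, g (f (g y)) = g y := by
  obtain ⟨r, hr⟩ := f.rangeRestrict.exists_rightInverse_of_surjective f.range_rangeRestrict
  obtain ⟨g, hg⟩ := r.exists_extend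
  have hfg : ∀ x, f (g (f x)) = f x := fun x => by
    have h₁ := LinearMap.congr_fun hg (f.rangeRestrict x)
    have h₂ := congrArg Subtype.val (LinearMap.congr_fun hr (f.rangeRestrict x))
    simp only [LinearMap.comp_apply] at h₁ h₂
    rw [← h₁] at h₂
    exact h₂
  exact ⟨g ∘ₗ f ∘ₗ g, fun x => by simp [hfg], fun y => by simp [hfg]⟩

theorem omitAt_eq_succAbove {k : ℕ} (i : Fin (k + 1)) (a : Fin k) :
    omitAt i a = i.succAbove a := by
  ext
  simp only [omitAt, Fin.succAbove, Fin.lt_def, Fin.val_castSucc]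
  split_ifs <;> simp

/-- Let `V`, `W` be complex vector spaces of dimensions `n ≤ m` and
`f : V → W` a linear map. For `b ∈ Hom(Sym^{m-n-1}V, 𝔰𝔩(W))` let `b ⊙ f` be the element
of `Hom(Sym^{m-n}V, W)` defined by `(b ⊙ f)(v₁⋯v_{m-n}) = Σᵢ b(v₁⋯v̂ᵢ⋯v_{m-n})(f(vᵢ))`.
Then the linear span of the two families `{f ∘ a : a ∈ Hom(Sym^{m-n}V, V)}` and
`{b ⊙ f : b ∈ Hom(Sym^{m-n-1}V, 𝔰𝔩(W))}` inside `Hom(Sym^{m-n}V, W)` equals the subspace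
`{η : η(Sym^{m-n}(ker f)) ⊆ im f}`, where `Sym^{m-n}(ker f)` is the image of the natural
map `Sym^{m-n}(ker f) → Sym^{m-n}V`. -/
theorem span_comp_and_odot_eq_preserving_subspace
    {V W : Type*} [AddCommGroup V] [Module ℂ V] [AddCommGroup W] [Module ℂ W]
    [FiniteDimensional ℂ V] [FiniteDimensional ℂ W] (n m : ℕ)
    (hV : Module.finrank ℂ V = n) (hW : Module.finrank ℂ W = m) (hnm : n ≤ m)
    (f : V →ₗ[ℂ] W)
    (odot : (SymPow ℂ V (m-n-1) →ₗ[ℂ] (LinearMap.ker (LinearMap.trace ℂ W))) →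
      (SymPow ℂ V (m-n) →ₗ[ℂ] W))
    (hodot : ∀ (b : SymPow ℂ V (m-n-1) →ₗ[ℂ] (LinearMap.ker (LinearMap.trace ℂ W)))
      (v : Fin (m-n) → V),
      odot b (SymPow.mk ℂ (m-n) v)
        = ∑ i : Fin (m-n),
            (b (SymPow.mk ℂ (m-n-1) (fun a : Fin (m-n-1) => v (omitAt i a)))).val
              (f (v i))) :
    (Submodule.span ℂ
        ({η | ∃ a : SymPow ℂ V (m-n) →ₗ[ℂ] V, η = f ∘ₗ a} ∪
          {η | ∃ b, η = odot b}) : Set (SymPow ℂ V (m-n) →ₗ[ℂ] W))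
      = {η | ∀ x ∈ Submodule.span ℂ {x : SymPow ℂ V (m-n) |
            ∃ v : Fin (m-n) → V, (∀ i, v i ∈ LinearMap.ker f) ∧ x = SymPow.mk ℂ (m-n) v},
          η x ∈ LinearMap.range f} := by
  generalize m - n = k at *
  apply Set.Subset.antisymm
  · intro η hη x hx
    rw [← Submodule.mem_comap]
    refine (Submodule.span_le.2 ?_ : _ ≤ (LinearMap.range f).comap η) hx
    rintro _ ⟨v, hv, rfl⟩
    rw [SetLike.mem_coe, Submodule.mem_comap]
    induction hη using Submodule.span_induction with
    | mem η hη =>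
      rcases hη with ⟨a, rfl⟩ | ⟨b, rfl⟩
      · exact ⟨_, rfl⟩
      · have h : ∀ i, f (v i) = 0 := hv
        simp [hodot, h]
    | zero => simp
    | add η₁ η₂ _ _ h₁ h₂ => exact Submodule.add_mem _ h₁ h₂
    | smul c η _ h => exact Submodule.smul_mem _ c h
  · intro η hη
    obtain ⟨g, hfg, hgf⟩ := f.exists_reflexive_pseudoinverse
    let P : V →ₗ[ℂ] V := g ∘ₗ f
    let q : W →ₗ[ℂ] W := LinearMap.id - f ∘ₗ g
    have hP : ∀ x, P (P x) = P x := fun x => hgf (f x)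
    have hq : ∀ x, q (f x) = 0 := fun x => by simp [q, hfg]
    have hgq : g ∘ₗ q = 0 := LinearMap.ext fun x => by simp [q, hgf]
    have hqq : ∀ x, q (q x) = q x := fun x => by simp [q, hfg]
    have hker : LinearMap.ker (SymPow.derivation P : SymPow ℂ V k →ₗ[ℂ] _)
        ≤ LinearMap.ker (q ∘ₗ η) := by
      intro x hx
      have hx' := SymPow.ker_derivation_le hP hx
      obtain ⟨y, hy⟩ := hη x <| Submodule.span_mono (by
        rintro _ ⟨v, hv, rfl⟩
        refine ⟨v, fun i => ?_, rfl⟩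
        rw [LinearMap.mem_ker, ← hfg]
        exact (congrArg f (hv i)).trans f.map_zero) hx'
      simp [← hy, hq]
    obtain ⟨l, hl⟩ := LinearMap.exists_comp_eq_of_ker_le_ker _ _ hker
    have hsplit : η = f ∘ₗ (g ∘ₗ η) + q ∘ₗ η := LinearMap.ext fun x => by simp [q]
    rw [hsplit]
    refine Submodule.add_mem _ (Submodule.subset_span (Or.inl ⟨_, rfl⟩)) ?_
    rcases k with _ | k
    · have : q ∘ₗ η = 0 := SymPow.hom_ext fun v => by
        rw [← hl]
        simp [SymPow.derivation_mk]
      rw [this]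
      exact Submodule.zero_mem _
    · let B : SymPow ℂ V k →ₗ[ℂ] W →ₗ[ℂ] W :=
        (LinearMap.llcomp ℂ W (SymPow ℂ V (k + 1)) W (q ∘ₗ l)) ∘ₗ (SymPow.mul ∘ₗ g).flip
      have hB : ∀ u w, B u w = q (l (SymPow.mul (g w) u)) := fun _ _ => rfl
      have htr : ∀ u, B u ∈ LinearMap.ker (LinearMap.trace ℂ W) := by
        intro u
        have : B u = q ∘ₗ ((l ∘ₗ (SymPow.mul (R := ℂ) (N := V)).flip u) ∘ₗ g) := LinearMap.ext fun w => rfl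
        rw [LinearMap.mem_ker, this, LinearMap.trace_comp_comm', LinearMap.comp_assoc, hgq]
        simp
      refine Submodule.subset_span (Or.inr ⟨B.codRestrict _ htr, SymPow.hom_ext fun v => ?_⟩)
      rw [hodot]
      have hv : ∀ i : Fin (k + 1), (fun a : Fin k => v (omitAt i a)) = i.removeNth v := fun i => by
        ext a
        rw [omitAt_eq_succAbove]
        rfl
      have hterm : ∀ i : Fin (k + 1),
          ((B.codRestrict _ htr) (SymPow.mk ℂ k fun a : Fin k => v (omitAt i a))).val (f (v i))
            = q (l (SymPow.mk ℂ (k + 1) (Function.update v i (P (v i))))) := fun i => by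
        rw [hv, LinearMap.codRestrict_apply, hB, SymPow.mul_mk_removeNth]
        rfl
      refine Eq.trans ?_ (Finset.sum_congr rfl fun i _ => hterm i).symm
      rw [← map_sum, ← map_sum, ← SymPow.derivation_mk, ← LinearMap.comp_apply l, hl]
      exact (hqq _).symm
end
end
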